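/- arXiv:1604.03461 — 3 statements merged into one kernel-verified Lean document; each statement's English description precedes it below -/
import Mathlib

section
/- Let N, k ∈ ℕ, ρ ∈ (0,1], and suppose (x_i)_{i=1}^{N^k} is a normalized ℓ₁⁺-ρ-sequence in some Banach space X. Then there exist finite nonempty sets of indices I_1 < I_2 < ... < I_N (meaning max I_j < min I_{j+1}) contained in {1,...,N^k} and nonnegative scalars (a_i) such that, setting u_j = Σ_{i∈I_j} a_i x_i, each u_j ≠ 0 and the normalized block sequence (u_j/‖u_j‖)_{j=1}^N is an ℓ₁⁺-ρ^{1/k}-sequence. -/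
set_option maxSynthPendingDepth 3
set_option maxHeartbeats 1000000
set_option synthInstance.maxHeartbeats 400000

noncomputable section

/-- `(eᵢ)` is a normalized monotone basic sequence: all `eᵢ` are unit vectors and the basis
projections onto initial segments have norm at most `1` (Grunblum's criterion with
constant `1`). -/
def IsNormalizedMonotoneBasicSeq {X : Type*} [NormedAddCommGroup X] [NormedSpace ℝ X]
    (e : ℕ → X) : Prop :=
  (∀ i, ‖e i‖ = 1) ∧
  ∀ m n : ℕ, m ≤ n → ∀ a : ℕ → ℝ,
    ‖∑ i ∈ Finset.range m, a i • e i‖ ≤ ‖∑ i ∈ Finset.range n, a i • e i‖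

/-- `(zⱼ)_{j < m}` is a block sequence of `(eᵢ)`: `zⱼ = ∑_{i ∈ Iⱼ} bᵢ • eᵢ` with finite
nonempty supports `Iⱼ` satisfying `max Iⱼ < min I_k` for `j < k`. -/
def IsBlockSeqOf {X : Type*} [NormedAddCommGroup X] [NormedSpace ℝ X]
    (e : ℕ → X) {m : ℕ} (z : Fin m → X) : Prop :=
  ∃ (I : Fin m → Finset ℕ) (b : ℕ → ℝ),
    (∀ j, (I j).Nonempty) ∧
    (∀ j k : Fin m, j < k → ∀ i ∈ I j, ∀ i' ∈ I k, i < i') ∧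
    (∀ j, z j = ∑ i ∈ I j, b i • e i)

/-- `(xⱼ)_{j < m}` is an `ℓ₁⁺`-`ρ`-sequence: it consists of unit vectors and
`‖∑ⱼ aⱼ xⱼ‖ ≥ ρ ∑ⱼ aⱼ` for all nonnegative scalars `(aⱼ)`. -/
def IsEll1PlusSeq {X : Type*} [NormedAddCommGroup X] [NormedSpace ℝ X]
    (ρ : ℝ) {m : ℕ} (x : Fin m → X) : Prop :=
  (∀ j, ‖x j‖ = 1) ∧
  ∀ a : Fin m → ℝ, (∀ j, 0 ≤ a j) → ρ * ∑ j, a j ≤ ‖∑ j, a j • x j‖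

/-- `x` admits `N` nonzero blocks with nonnegative coefficients whose normalizations form an
`ℓ₁⁺`-`θ`-sequence. -/
def HasEll1PlusBlocks {X : Type*} [NormedAddCommGroup X] [NormedSpace ℝ X] {ι : Type*}
    [LinearOrder ι] (N : ℕ) (θ : ℝ) (x : ι → X) : Prop :=
  ∃ (I : Fin N → Finset ι) (a : ι → ℝ),
    (∀ j, (I j).Nonempty) ∧
    (∀ j j' : Fin N, j < j' → ∀ i ∈ I j, ∀ i' ∈ I j', i < i') ∧
    (∀ i, 0 ≤ a i) ∧
    (∀ j, (∑ i ∈ I j, a i • x i) ≠ 0) ∧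
    IsEll1PlusSeq θ
      (fun j : Fin N => ‖∑ i ∈ I j, a i • x i‖⁻¹ • ∑ i ∈ I j, a i • x i)

/-- Blocks of a subsequence are blocks of the whole sequence. -/
theorem HasEll1PlusBlocks.of_comp {X : Type*} [NormedAddCommGroup X] [NormedSpace ℝ X]
    {ι κ : Type*} [LinearOrder ι] [LinearOrder κ] {N : ℕ} {θ : ℝ} {x : ι → X} {e : κ → ι}
    (he : StrictMono e) (h : HasEll1PlusBlocks N θ (x ∘ e)) : HasEll1PlusBlocks N θ x := by
  obtain ⟨I, a, hne, hlt, ha, hu, hl⟩ := h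
  have hsum (j : Fin N) :
      ∑ i ∈ (I j).map ⟨e, he.injective⟩, Function.extend e a 0 i • x i =
        ∑ i ∈ I j, a i • (x ∘ e) i := by
    simp [Finset.sum_map, he.injective.extend_apply]
  refine ⟨fun j => (I j).map ⟨e, he.injective⟩, Function.extend e a 0, ?_, ?_, ?_, ?_, ?_⟩
  · simpa using hne
  · intro j j' hj i hi i' hi'
    simp only [Finset.mem_map, Function.Embedding.coeFn_mk] at hi hi'
    obtain ⟨p, hp, rfl⟩ := hi
    obtain ⟨q, hq, rfl⟩ := hi'
    exact he (hlt j j' hj p hp q hq)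
  · intro i
    by_cases hi : ∃ p, e p = i
    · obtain ⟨p, rfl⟩ := hi
      rw [he.injective.extend_apply]
      exact ha p
    · simp [Function.extend_apply' _ _ _ hi]
  · intro j
    rw [hsum]
    exact hu j
  · simpa only [hsum] using hl

/-- Singletons are blocks. -/
theorem IsEll1PlusSeq.hasEll1PlusBlocks {X : Type*} [NormedAddCommGroup X] [NormedSpace ℝ X]
    {N : ℕ} {θ : ℝ} {x : Fin N → X} (hx : IsEll1PlusSeq θ x) : HasEll1PlusBlocks N θ x := by
  refine ⟨fun j => {j}, 1, by simp, ?_, by simp, ?_, ?_⟩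
  · simp
  · intro j
    have := hx.1 j
    simp only [Finset.sum_singleton, Pi.one_apply, one_smul]
    rintro h
    simp [h] at this
  · simpa [hx.1] using hx

/-- If `(xᵢ)` is an `ℓ₁⁺`-`σθ`-sequence cut into `N` consecutive blocks of length `m`, then either
one of the blocks is an `ℓ₁⁺`-`σ`-sequence, or suitable combinations over the blocks normalize to
an `ℓ₁⁺`-`θ`-sequence. -/
theorem IsEll1PlusSeq.exists_block_or_hasEll1PlusBlocks {X : Type*} [NormedAddCommGroup X]
    [NormedSpace ℝ X] {n N m : ℕ} {σ θ : ℝ} (hσ : 0 < σ) (hθ : 0 < θ)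
    (E : Fin N × Fin m ≃ Fin n)
    (hE : ∀ j j' : Fin N, j < j' → ∀ i i', E (j, i) < E (j', i'))
    {x : Fin n → X} (hx : IsEll1PlusSeq (σ * θ) x) :
    (∃ j, IsEll1PlusSeq σ fun i => x (E (j, i))) ∨ HasEll1PlusBlocks N θ x := by
  refine or_iff_not_imp_left.2 fun hno => ?_
  have hex (j : Fin N) : ∃ c : Fin m → ℝ, (∀ i, 0 ≤ c i) ∧
      ‖∑ i, c i • x (E (j, i))‖ < σ * ∑ i, c i := by
    by_contra! hcon
    exact hno ⟨j, fun i => hx.1 _, hcon⟩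
  choose c hc hlt using hex
  set u : Fin N → X := fun j => ∑ i, c j i • x (E (j, i)) with hu
  have hS (j : Fin N) : 0 < ∑ i, c j i :=
    pos_of_mul_pos_right ((norm_nonneg _).trans_lt (hlt j)) hσ.le
  have hlow (b : Fin N → ℝ) (hb : ∀ j, 0 ≤ b j) :
      σ * θ * ∑ j, b j * ∑ i, c j i ≤ ‖∑ j, b j • u j‖ := by
    have h := hx.2 (fun t => b (E.symm t).1 * c (E.symm t).1 (E.symm t).2)
      fun t => mul_nonneg (hb _) (hc _ _)
    rw [← E.sum_comp, ← E.sum_comp, Fintype.sum_prod_type, Fintype.sum_prod_type] at h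
    simpa [hu, Finset.mul_sum, Finset.smul_sum, mul_smul] using h
  have hpos (j : Fin N) : 0 < ‖u j‖ := by
    have h := hlow (Pi.single j 1) (fun i => by
      by_cases hij : i = j
      · subst hij; simp
      · simp [hij])
    simp only [Pi.single_apply, ite_mul, one_mul, zero_mul, ite_smul, one_smul, zero_smul,
      Finset.sum_ite_eq', Finset.mem_univ, if_true] at h
    exact (mul_pos (mul_pos hσ hθ) (hS j)).trans_le h
  let e (j : Fin N) : Fin m ↪ Fin n := (Function.Embedding.sectR j (Fin m)).trans E.toEmbedding
  have hsum (j : Fin N) : ∑ t ∈ Finset.univ.map (e j), c (E.symm t).1 (E.symm t).2 • x t = u j := by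
    simp [hu, e, Finset.sum_map]
  refine ⟨fun j => Finset.univ.map (e j), fun t => c (E.symm t).1 (E.symm t).2, ?_, ?_, fun t => hc _ _, ?_, ?_⟩
  · intro j
    rw [Finset.map_nonempty]
    exact Finset.nonempty_of_sum_ne_zero (hS j).ne'
  · intro j j' hj i hi i' hi'
    simp only [Finset.mem_map, Finset.mem_univ, true_and] at hi hi'
    obtain ⟨p, rfl⟩ := hi
    obtain ⟨q, rfl⟩ := hi'
    exact hE j j' hj p q
  · intro j
    rw [hsum]
    exact norm_pos_iff.1 (hpos j)
  · simp only [hsum]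
    refine ⟨fun j => by rw [norm_smul, norm_inv, norm_norm, inv_mul_cancel₀ (hpos j).ne'], ?_⟩
    intro b hb
    have h := hlow (fun j => b j * ‖u j‖⁻¹) fun j => mul_nonneg (hb j) (inv_pos.2 (hpos j)).le
    simp only [mul_smul] at h
    refine le_trans ?_ h
    rw [Finset.mul_sum, Finset.mul_sum]
    refine Finset.sum_le_sum fun j _ => ?_
    have hone : 1 ≤ ‖u j‖⁻¹ * (σ * ∑ i, c j i) := by
      rw [inv_mul_eq_div, one_le_div (hpos j)]
      exact (hlt j).le
    calc θ * b j ≤ θ * b j * (‖u j‖⁻¹ * (σ * ∑ i, c j i)) :=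
          le_mul_of_one_le_right (mul_nonneg hθ.le (hb j)) hone
      _ = σ * θ * (b j * ‖u j‖⁻¹ * ∑ i, c j i) := by ring

/-- An `ℓ₁⁺`-`θ^(k+1)`-sequence of length `N^(k+1)` admits `N` blocks whose normalizations form an
`ℓ₁⁺`-`θ`-sequence. -/
theorem IsEll1PlusSeq.hasEll1PlusBlocks_of_pow {X : Type*} [NormedAddCommGroup X]
    [NormedSpace ℝ X] {N : ℕ} {θ : ℝ} (hθ : 0 < θ) (k : ℕ) {x : Fin (N ^ (k + 1)) → X}
    (hx : IsEll1PlusSeq (θ ^ (k + 1)) x) : HasEll1PlusBlocks N θ x := by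
  induction k with
  | zero =>
    have hcast : StrictMono (Fin.cast (by simp : N = N ^ (0 + 1))) := fun _ _ h => h
    refine HasEll1PlusBlocks.of_comp hcast (IsEll1PlusSeq.hasEll1PlusBlocks ?_)
    refine ⟨fun j => hx.1 _, fun a ha => ?_⟩
    have h := hx.2 (a ∘ Fin.cast (by simp)) fun j => ha _
    rw [← (finCongr (by simp : N = N ^ (0 + 1))).sum_comp,
      ← (finCongr (by simp : N = N ^ (0 + 1))).sum_comp] at h
    simpa using h
  | succ k ih =>
    let E : Fin N × Fin (N ^ (k + 1)) ≃ Fin (N ^ (k + 1 + 1)) :=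
      finProdFinEquiv.trans (finCongr (pow_succ' N (k + 1)).symm)
    have hval (j : Fin N) (i : Fin (N ^ (k + 1))) :
        (E (j, i) : ℕ) = i + N ^ (k + 1) * j := rfl
    rw [pow_succ] at hx
    obtain ⟨j, hj⟩ | h := hx.exists_block_or_hasEll1PlusBlocks (pow_pos hθ _) hθ E (by
      intro j j' hj i i'
      rw [Fin.lt_def, hval, hval]
      have := i.isLt
      have := Nat.mul_le_mul_left (N ^ (k + 1)) (Nat.succ_le_of_lt (Fin.lt_def.1 hj))
      rw [Nat.mul_succ] at this
      omega)
    · refine HasEll1PlusBlocks.of_comp (e := fun i => E (j, i)) ?_ (ih hj)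
      intro i i' hi
      rw [Fin.lt_def, hval, hval]
      exact Nat.add_lt_add_right hi _
    · exact h

/-- James' blocking argument for `ℓ₁⁺`-sequences: if `(xᵢ)_{i < N^k}` is a normalized
`ℓ₁⁺`-`ρ`-sequence, then it admits a normalized block subsequence of length `N` (built
from nonnegative coefficients over consecutive blocks of indices) which is an
`ℓ₁⁺`-`ρ^{1/k}`-sequence. -/
theorem exists_block_ell1Plus_seq
    (X : Type*) [NormedAddCommGroup X] [NormedSpace ℝ X] [CompleteSpace X]
    (N k : ℕ) (hN : 0 < N) (hk : 0 < k) (ρ : ℝ) (hρ0 : 0 < ρ) (hρ1 : ρ ≤ 1)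
    (x : Fin (N ^ k) → X) (hx : IsEll1PlusSeq ρ x) :
    ∃ (I : Fin N → Finset (Fin (N ^ k))) (a : Fin (N ^ k) → ℝ),
      (∀ j, (I j).Nonempty) ∧
      (∀ j j' : Fin N, j < j' → ∀ i ∈ I j, ∀ i' ∈ I j', i < i') ∧
      (∀ i, 0 ≤ a i) ∧
      (∀ j, (∑ i ∈ I j, a i • x i) ≠ 0) ∧
      IsEll1PlusSeq (ρ ^ ((1 : ℝ) / k))
        (fun j : Fin N => ‖∑ i ∈ I j, a i • x i‖⁻¹ • ∑ i ∈ I j, a i • x i) := by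
  obtain ⟨k, rfl⟩ := Nat.exists_eq_succ_of_ne_zero hk.ne'
  refine IsEll1PlusSeq.hasEll1PlusBlocks_of_pow (Real.rpow_pos_of_pos hρ0 _) k ?_
  rwa [one_div, Real.rpow_inv_natCast_pow hρ0.le k.succ_ne_zero]
end
end

section
/- There exists an ℓ₁⁺-method {(Φ_a, ρ_a)}_{a>1} (indexed by real numbers a > 1) satisfying: (a) for all η > 0 and p ≥ 1 there exist δ > 0, a > 1 and C_0 > c_a such that Φ_a(n, C) ≤ p + η for every C ≥ C_0 and every natural number n ≤ ρ_a(C)^{−p−δ}; and (b) lim_{C→∞} ρ_a(C) = 0 for each a > 1. -/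
set_option maxSynthPendingDepth 3
set_option maxHeartbeats 1000000
set_option synthInstance.maxHeartbeats 400000

noncomputable section

/-- `(eᵢ)` satisfies subsequential `C`-`ℓ_q`-upper block estimates: every normalized block
sequence `(zⱼ)` of `(eᵢ)` satisfies `‖∑ⱼ aⱼ zⱼ‖ ≤ C (∑ⱼ |aⱼ|^q)^{1/q}` for all scalars. -/
def HasSubseqUpperLqBlockEstimates {X : Type*} [NormedAddCommGroup X] [NormedSpace ℝ X]
    (e : ℕ → X) (C q : ℝ) : Prop :=
  ∀ (m : ℕ) (z : Fin m → X), IsBlockSeqOf e z → (∀ j, ‖z j‖ = 1) →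
    ∀ a : Fin m → ℝ, ‖∑ j, a j • z j‖ ≤ C * (∑ j, |a j| ^ q) ^ (1 / q)

/-- An `ℓ₁⁺`-method: a family, indexed by `a : A`, of constants `c a ≥ 1` and functions
`Φ a : ℕ × (c_a, ∞) → (0, ∞)`, `ρ a : (c_a, ∞) → (0, 1]` such that for every `a`, `n`,
`C > c a`, every Banach space `X` and every normalized monotone basic sequence `(eᵢ)` in
`X`: if no normalized block sequence of `(eᵢ)` of length `n` is an
`ℓ₁⁺`-`(ρ a C)`-sequence, then for every exponent `p > 1` with `p ≥ Φ a (n, C)` the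
sequence `(eᵢ)` satisfies subsequential `C`-`ℓ_{p'}`-upper block estimates. -/
structure Ell1PlusMethod (A : Type*) where
  c : A → ℝ
  Phi : A → ℕ → ℝ → ℝ
  rho : A → ℝ → ℝ
  one_le_c : ∀ a, 1 ≤ c a
  Phi_pos : ∀ a n C, c a < C → 0 < Phi a n C
  rho_pos : ∀ a C, c a < C → 0 < rho a C
  rho_le_one : ∀ a C, c a < C → rho a C ≤ 1
  estimate : ∀ (a : A) (n : ℕ) (C : ℝ), c a < C →
    ∀ (X : Type) [NormedAddCommGroup X] [NormedSpace ℝ X] (e : ℕ → X),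
      IsNormalizedMonotoneBasicSeq e →
      (¬ ∃ z : Fin n → X, IsBlockSeqOf e z ∧ IsEll1PlusSeq (rho a C) z) →
      ∀ p : ℝ, 1 < p → Phi a n C ≤ p →
        HasSubseqUpperLqBlockEstimates e C (p / (p - 1))

section Combinatorics

variable {ι : Type*} [LinearOrder ι]

/-- A predicate which fails for `∅` and holds for `J` has a shortest initial segment of `J` for which
it holds. -/
theorem exists_first_initial_segment (Big : Finset ι → Prop) (h_empty : ¬ Big ∅) (J : Finset ι)
    (hJ : Big J) :
    ∃ j ∈ J, Big (J.filter (· ≤ j)) ∧ ¬ Big (J.filter (· < j)) := by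
  induction J using Finset.induction_on_max with
  | empty => exact absurd hJ h_empty
  | insert a s hs ih =>
    have has : a ∉ s := fun h => lt_irrefl _ (hs a h)
    by_cases hbig : Big s
    · obtain ⟨j, hj, h1, h2⟩ := ih hbig
      have hja := hs j hj
      refine ⟨j, Finset.mem_insert_of_mem hj, ?_, ?_⟩
      · rwa [Finset.filter_insert, if_neg (not_le.2 hja)]
      · rwa [Finset.filter_insert, if_neg hja.le.not_gt]
    · refine ⟨a, Finset.mem_insert_self _ _, ?_, ?_⟩
      · rwa [Finset.filter_true_of_mem]
        intro x hx
        rcases Finset.mem_insert.1 hx with rfl | hx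
        · exact le_rfl
        · exact (hs x hx).le
      · rwa [Finset.filter_insert, if_neg (lt_irrefl a), Finset.filter_true_of_mem hs]

/-- Greedy decomposition: either `J` contains `n` successive sets satisfying `Big`, or the number
of elements of `J` with property `P` is controlled by its values on sets which are not `Big`. -/
theorem exists_successive_or_card_lt (Big : Finset ι → Prop) (h_empty : ¬ Big ∅)
    (P : ι → Prop) [DecidablePred P] (M : ℕ) (n : ℕ) (J : Finset ι)
    (hM : ∀ K ⊆ J, ¬ Big K → (K.filter P).card < M) :
    (∃ K : Fin n → Finset ι, (∀ i, K i ⊆ J) ∧ (∀ i, Big (K i)) ∧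
      ∀ i k, i < k → ∀ x ∈ K i, ∀ y ∈ K k, x < y) ∨ (J.filter P).card < n * M := by
  induction n generalizing J with
  | zero => exact Or.inl ⟨Fin.elim0, fun i => i.elim0, fun i => i.elim0, fun i => i.elim0⟩
  | succ n ih =>
    by_cases hJ : Big J
    · obtain ⟨j, hj, h1, h2⟩ := exists_first_initial_segment Big h_empty J hJ
      have hsub : J.filter (j < ·) ⊆ J := Finset.filter_subset _ _
      rcases ih (J.filter (j < ·)) (fun K hK => hM K (hK.trans hsub)) with ⟨K, hK, hB, hlt⟩ | hcard
      · left
        refine ⟨Fin.cons (J.filter (· ≤ j)) K, ?_, ?_, ?_⟩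
        · intro i
          refine Fin.cases ?_ (fun i => ?_) i
          · exact Finset.filter_subset _ _
          · exact (hK i).trans hsub
        · intro i
          refine Fin.cases ?_ (fun i => ?_) i
          · exact h1
          · exact hB i
        · intro i k
          refine Fin.cases ?_ (fun i => ?_) i <;> refine Fin.cases ?_ (fun k => ?_) k
          · intro h; exact absurd h (lt_irrefl _)
          · intro _ x hx y hy
            exact lt_of_le_of_lt (Finset.mem_filter.1 hx).2 (Finset.mem_filter.1 (hK k hy)).2
          · intro h; exact absurd h (Fin.not_lt_zero _)
          · intro h
            exact hlt i k (Fin.succ_lt_succ_iff.1 h)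
      · right
        have h3 := hM _ (Finset.filter_subset _ _) h2
        have hcover : J.filter P ⊆
            insert j ((J.filter (· < j)).filter P ∪ (J.filter (j < ·)).filter P) := by
          intro x hx
          have hx' := Finset.mem_filter.1 hx
          rcases lt_trichotomy x j with h | h | h <;> simp [hx'.1, hx'.2, h]
        have h4 := (Finset.card_le_card hcover).trans (Finset.card_insert_le _ _)
        have h5 := Finset.card_union_le ((J.filter (· < j)).filter P) ((J.filter (j < ·)).filter P)
        rw [Nat.succ_mul]
        omega
    · right
      have := hM J subset_rfl hJ
      exact this.trans_le (Nat.le_mul_of_pos_left M n.succ_pos)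

end Combinatorics

theorem exists_glued_function {ι α : Type*} (S : ι → Finset α) (β : ι → α → ℝ)
    (hS : ∀ i k, ∀ l ∈ S i, l ∈ S k → i = k) :
    ∃ γ : α → ℝ, ∀ i, ∀ l ∈ S i, γ l = β i l := by
  classical
  refine ⟨fun l => if h : ∃ i, l ∈ S i then β h.choose l else 0, fun i l hl => ?_⟩
  have h : ∃ i, l ∈ S i := ⟨i, hl⟩
  simp only [dif_pos h]
  rw [hS _ _ l h.choose_spec hl]

theorem eq_of_mem_of_successive {ι α : Type*} [LinearOrder ι] [Preorder α] {S : ι → Finset α}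
    (hS : ∀ i k, i < k → ∀ x ∈ S i, ∀ y ∈ S k, x < y) (i k : ι) (l : α) (hi : l ∈ S i)
    (hk : l ∈ S k) : i = k := by
  rcases lt_trichotomy i k with h | h | h
  · exact absurd (hS i k h l hi l hk) (lt_irrefl l)
  · exact h
  · exact absurd (hS k i h l hk l hi) (lt_irrefl l)

section Blocks

variable {X : Type*} [NormedAddCommGroup X] [NormedSpace ℝ X]

/-- A block sequence of a block sequence is a block sequence. -/
theorem IsBlockSeqOf.of_blocks {e : ℕ → X} {m : ℕ} {z : Fin m → X} (hz : IsBlockSeqOf e z)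
    {n : ℕ} (K : Fin n → Finset (Fin m)) (hne : ∀ i, (K i).Nonempty)
    (hlt : ∀ i k, i < k → ∀ x ∈ K i, ∀ y ∈ K k, x < y) (c : Fin n → Fin m → ℝ) :
    IsBlockSeqOf e (fun i => ∑ j ∈ K i, c i j • z j) := by
  classical
  obtain ⟨I, b, hI, hIlt, hzb⟩ := hz
  obtain ⟨c', hc'⟩ := exists_glued_function K c (eq_of_mem_of_successive hlt)
  have hIeq := eq_of_mem_of_successive hIlt
  obtain ⟨b', hb'⟩ := exists_glued_function I (fun j l => c' j * b l) hIeq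
  refine ⟨fun i => (K i).biUnion I, b', ?_, ?_, ?_⟩
  · intro i
    obtain ⟨j, hj⟩ := hne i
    obtain ⟨l, hl⟩ := hI j
    exact ⟨l, Finset.mem_biUnion.2 ⟨j, hj, hl⟩⟩
  · intro i k hik l hl l' hl'
    obtain ⟨j, hj, hlj⟩ := Finset.mem_biUnion.1 hl
    obtain ⟨j', hj', hlj'⟩ := Finset.mem_biUnion.1 hl'
    exact hIlt j j' (hlt i k hik j hj j' hj') l hlj l' hlj'
  · intro i
    rw [Finset.sum_biUnion]
    · refine Finset.sum_congr rfl fun j hj => ?_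
      rw [hzb, Finset.smul_sum]
      refine Finset.sum_congr rfl fun l hl => ?_
      rw [hb' j l hl, hc' i j hj, smul_smul]
    · intro j _ j' _ hne'
      exact Finset.disjoint_left.2 fun l hl hl' => hne' (hIeq j j' l hl hl')

/-- If no normalized block sequence of length `n` is an `ℓ₁⁺`-`ρ`-sequence, then a functional
bounded by `s` on the span of a normalized block sequence exceeds `s * ρ ^ k` in absolute value on
fewer than `n ^ k` of its terms. -/
theorem card_lt_pow_of_no_ell1Plus {e : ℕ → X} {n : ℕ} {ρ : ℝ} (hρ : 0 < ρ)
    (hno : ¬ ∃ z : Fin n → X, IsBlockSeqOf e z ∧ IsEll1PlusSeq ρ z)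
    {m : ℕ} {z : Fin m → X} (hz : IsBlockSeqOf e z) (hz1 : ∀ j, ‖z j‖ = 1) (f : X →ₗ[ℝ] ℝ)
    (k : ℕ) (s : ℝ) (hs : 0 < s) (J : Finset (Fin m))
    (hJ : ∀ c : Fin m → ℝ, f (∑ j ∈ J, c j • z j) ≤ s * ‖∑ j ∈ J, c j • z j‖) :
    (J.filter (fun j => s * ρ ^ k < |f (z j)|)).card < n ^ k := by
  induction k generalizing s J with
  | zero =>
    rw [Finset.filter_false_of_mem]
    · simp
    intro j hj
    have key : ∀ t : ℝ, t * f (z j) ≤ s * |t| := by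
      intro t
      have h := hJ (fun i => if i = j then t else 0)
      have h2 : ∑ i ∈ J, (if i = j then t else 0) • z i = t • z j := by
        simp [ite_smul, hj]
      rw [h2, map_smul, norm_smul, hz1, smul_eq_mul, Real.norm_eq_abs, mul_one] at h
      exact h
    have h1 := key 1
    have h2 := key (-1)
    simp only [abs_neg, abs_one] at h1 h2
    rw [pow_zero, mul_one, not_lt, abs_le]
    constructor <;> linarith
  | succ k ih =>
    let Big : Finset (Fin m) → Prop := fun K =>
      ∃ c : Fin m → ℝ, s * ρ * ‖∑ j ∈ K, c j • z j‖ < f (∑ j ∈ K, c j • z j)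
    have h_empty : ¬ Big ∅ := by
      rintro ⟨c, hc⟩
      simp at hc
    have hsmall : ∀ K ⊆ J, ¬ Big K →
        (K.filter (fun j => s * ρ ^ (k + 1) < |f (z j)|)).card < n ^ k := by
      intro K _ hnot
      have h := ih (s * ρ) (mul_pos hs hρ) K fun c => by
        by_contra hcon
        exact hnot ⟨c, not_le.1 hcon⟩
      simpa only [pow_succ', mul_assoc] using h
    rcases exists_successive_or_card_lt Big h_empty
      (fun j => s * ρ ^ (k + 1) < |f (z j)|) (n ^ k) n J hsmall with ⟨K, hKJ, hB, hlt⟩ | h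
    · exfalso
      choose c hc using hB
      have hpos : ∀ i, 0 < ‖∑ j ∈ K i, c i j • z j‖ := by
        intro i
        rw [norm_pos_iff]
        intro h0
        have := hc i
        simp [h0] at this
      let d : Fin n → Fin m → ℝ := fun i j => ‖∑ j ∈ K i, c i j • z j‖⁻¹ * c i j
      have hd : ∀ i, ∑ j ∈ K i, d i j • z j
          = ‖∑ j ∈ K i, c i j • z j‖⁻¹ • ∑ j ∈ K i, c i j • z j := by
        intro i
        simp only [d, mul_smul, Finset.smul_sum]
      have hfd : ∀ i, s * ρ ≤ f (∑ j ∈ K i, d i j • z j) := by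
        intro i
        rw [hd, map_smul, smul_eq_mul, inv_mul_eq_div, le_div_iff₀ (hpos i)]
        exact (hc i).le
      refine hno ⟨fun i => ∑ j ∈ K i, d i j • z j, hz.of_blocks K ?_ hlt d, ?_, ?_⟩
      · intro i
        rw [Finset.nonempty_iff_ne_empty]
        intro h0
        have := hpos i
        simp [h0] at this
      · intro i
        simp only [hd]
        rw [norm_smul, norm_inv, norm_norm, inv_mul_cancel₀ (hpos i).ne']
      · intro a ha
        obtain ⟨g, hg⟩ := exists_glued_function K (fun i j => a i * d i j)
          (eq_of_mem_of_successive hlt)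
        have hsum : ∑ i, a i • ∑ j ∈ K i, d i j • z j
            = ∑ j ∈ J, (if j ∈ Finset.univ.biUnion K then g j else 0) • z j := by
          simp only [ite_smul, zero_smul]
          rw [← Finset.sum_filter, Finset.filter_mem_eq_inter,
            Finset.inter_eq_right.2 (Finset.biUnion_subset.2 fun i _ => hKJ i),
            Finset.sum_biUnion]
          · refine Finset.sum_congr rfl fun i _ => ?_
            rw [Finset.smul_sum]
            refine Finset.sum_congr rfl fun j hj => ?_
            rw [hg i j hj, smul_smul]
          · intro i _ i' _ hne'
            exact Finset.disjoint_left.2 fun l hl hl' =>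
              hne' (eq_of_mem_of_successive hlt i i' l hl hl')
        have h1 := hJ (fun j => if j ∈ Finset.univ.biUnion K then g j else 0)
        rw [← hsum] at h1
        have h2 : s * ρ * ∑ i, a i ≤ f (∑ i, a i • ∑ j ∈ K i, d i j • z j) := by
          rw [map_sum, Finset.mul_sum]
          refine Finset.sum_le_sum fun i _ => ?_
          rw [map_smul, smul_eq_mul, mul_comm]
          exact mul_le_mul_of_nonneg_left (hfd i) (ha i)
        have h3 := h2.trans h1
        rw [mul_assoc] at h3
        exact le_of_mul_le_mul_left h3 hs
    · exact h.trans_eq (pow_succ' n k).symm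

end Blocks

/-- A finite family in `[0, 1]` with fewer than `n ^ k` members above `ρ ^ k` for every `k` has
`p`-th power sum at most `2 * n`, provided that `2 * n * ρ ^ p ≤ 1`. -/
theorem sum_rpow_le_of_card_lt_pow {ι : Type*} (J : Finset ι) (v : ι → ℝ)
    (hv0 : ∀ j ∈ J, 0 ≤ v j) (hv1 : ∀ j ∈ J, v j ≤ 1) {ρ : ℝ} (hρ0 : 0 < ρ) (hρ1 : ρ < 1)
    (n : ℕ) (hcard : ∀ k : ℕ, (J.filter (fun j => ρ ^ k < v j)).card < n ^ k)
    {p : ℝ} (hp : 0 < p) (hnp : 2 * n * ρ ^ p ≤ 1) :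
    ∑ j ∈ J, v j ^ p ≤ 2 * n := by
  have hlevel : ∀ j ∈ J, ∃ k : ℕ, v j ≤ ρ ^ k ∧ (0 < v j → ρ ^ (k + 1) < v j) := by
    intro j hj
    rcases (hv0 j hj).eq_or_lt with h | h
    · exact ⟨0, by simp [← h], fun h' => absurd h' (by simp [← h])⟩
    · obtain ⟨k, h1, h2⟩ := exists_nat_pow_near_of_lt_one h (hv1 j hj) hρ0 hρ1
      exact ⟨k, h2, fun _ => h1⟩
  choose! κ hκ1 hκ2 using hlevel
  set N := J.sup κ + 1 with hN
  have hterm : ∀ j ∈ J, v j ^ p ≤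
      ∑ k ∈ Finset.range N, if ρ ^ (k + 1) < v j then (ρ ^ p) ^ k else 0 := by
    intro j hj
    have hnn : ∀ k ∈ Finset.range N, 0 ≤ if ρ ^ (k + 1) < v j then (ρ ^ p) ^ k else 0 := by
      intro k _
      split_ifs <;> positivity
    rcases (hv0 j hj).eq_or_lt with h | h
    · refine le_of_eq_of_le ?_ (Finset.sum_nonneg hnn)
      rw [← h, Real.zero_rpow hp.ne']
    · have hmem : κ j ∈ Finset.range N :=
        Finset.mem_range.2 (Nat.lt_succ_of_le (Finset.le_sup hj))
      refine le_trans ?_ (Finset.single_le_sum hnn hmem)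
      rw [if_pos (hκ2 j hj h), ← Real.rpow_mul_natCast hρ0.le, mul_comm p,
        Real.rpow_natCast_mul hρ0.le]
      exact Real.rpow_le_rpow h.le (hκ1 j hj) hp.le
  calc ∑ j ∈ J, v j ^ p
      ≤ ∑ j ∈ J, ∑ k ∈ Finset.range N, if ρ ^ (k + 1) < v j then (ρ ^ p) ^ k else 0 :=
        Finset.sum_le_sum hterm
    _ = ∑ k ∈ Finset.range N, ((J.filter (fun j => ρ ^ (k + 1) < v j)).card : ℝ) * (ρ ^ p) ^ k := by
        rw [Finset.sum_comm]
        refine Finset.sum_congr rfl fun k _ => ?_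
        rw [← Finset.sum_filter, Finset.sum_const, nsmul_eq_mul]
    _ ≤ ∑ k ∈ Finset.range N, (n : ℝ) * (1 / 2) ^ k := by
        refine Finset.sum_le_sum fun k _ => ?_
        have h1 : ((J.filter (fun j => ρ ^ (k + 1) < v j)).card : ℝ) ≤ (n : ℝ) ^ (k + 1) := by
          exact_mod_cast (hcard (k + 1)).le
        have h2 : (n * ρ ^ p) ^ k ≤ (1 / 2 : ℝ) ^ k :=
          pow_le_pow_left₀ (by positivity) (by linarith) k
        calc _ ≤ (n : ℝ) ^ (k + 1) * (ρ ^ p) ^ k := by gcongr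
          _ = n * (n * ρ ^ p) ^ k := by rw [mul_pow]; ring
          _ ≤ _ := by gcongr
    _ = n * ∑ k ∈ Finset.range N, (1 / 2 : ℝ) ^ k := by rw [Finset.mul_sum]
    _ ≤ n * 2 := by gcongr; exact sum_geometric_two_le N
    _ = 2 * n := mul_comm _ _

/-- If no normalized block sequence of length `n` is an `ℓ₁⁺`-`C⁻¹`-sequence and `2 * n ≤ C ^ p`,
then subsequential `C`-`ℓ_{p'}`-upper block estimates hold. -/
theorem hasSubseqUpperLqBlockEstimates_of_no_ell1Plus {X : Type*} [NormedAddCommGroup X]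
    [NormedSpace ℝ X] {e : ℕ → X} {n : ℕ} {C : ℝ} (hC : 1 < C)
    (hno : ¬ ∃ z : Fin n → X, IsBlockSeqOf e z ∧ IsEll1PlusSeq C⁻¹ z)
    {p : ℝ} (hp : 1 < p) (hnp : 2 * n ≤ C ^ p) :
    HasSubseqUpperLqBlockEstimates e C (p / (p - 1)) := by
  intro m z hz hz1 a
  have hC0 : 0 < C := one_pos.trans hC
  obtain ⟨g, hg1, hgx⟩ := exists_dual_vector'' ℝ (∑ j, a j • z j)
  have hgle : ∀ x, |g x| ≤ ‖x‖ := fun x => by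
    simpa using g.le_of_opNorm_le hg1 x
  have hcard : ∀ k : ℕ, (Finset.univ.filter (fun j => C⁻¹ ^ k < |g (z j)|)).card < n ^ k := by
    intro k
    have h := card_lt_pow_of_no_ell1Plus (inv_pos.2 hC0) hno hz hz1 (g : X →ₗ[ℝ] ℝ) k 1 one_pos
      Finset.univ fun c => by
        rw [one_mul]
        exact (le_abs_self _).trans (hgle _)
    simpa using h
  have hCp : 0 < C ^ p := Real.rpow_pos_of_pos hC0 p
  have hsum : ∑ j, |g (z j)| ^ p ≤ C ^ p := by
    refine (sum_rpow_le_of_card_lt_pow Finset.univ _ (fun j _ => abs_nonneg _)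
      (fun j _ => (hgle _).trans_eq (hz1 j)) (inv_pos.2 hC0) (inv_lt_one_of_one_lt₀ hC) n hcard
      (one_pos.trans hp) ?_).trans hnp
    rw [Real.inv_rpow hC0.le, ← div_eq_mul_inv, div_le_one hCp]
    exact hnp
  have hpq : (p / (p - 1)).HolderConjugate p := (Real.HolderConjugate.conjExponent hp).symm
  calc ‖∑ j, a j • z j‖ = ∑ j, a j * g (z j) := by
        have h : g (∑ j, a j • z j) = ‖∑ j, a j • z j‖ := by simpa using hgx
        rw [← h, map_sum]
        simp
    _ ≤ (∑ j, |a j| ^ (p / (p - 1))) ^ (1 / (p / (p - 1))) * (∑ j, |g (z j)| ^ p) ^ (1 / p) :=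
        Real.inner_le_Lp_mul_Lq _ _ _ hpq
    _ ≤ (∑ j, |a j| ^ (p / (p - 1))) ^ (1 / (p / (p - 1))) * C := by
        gcongr
        calc (∑ j, |g (z j)| ^ p) ^ (1 / p) ≤ (C ^ p) ^ (1 / p) := by gcongr
          _ = C := by
            rw [one_div, Real.rpow_rpow_inv hC0.le (one_pos.trans hp).ne']
    _ = _ := mul_comm _ _

/-- The method with `ρ(C) = C⁻¹` and `Φ(n, C) = log (2 max(n, 1)) / log C`. -/
def logEll1PlusMethod (A : Type*) : Ell1PlusMethod A where
  c _ := 1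
  Phi _ n C := Real.log (2 * max (n : ℝ) 1) / Real.log C
  rho _ C := C⁻¹
  one_le_c _ := le_rfl
  Phi_pos _ n C hC := by
    have h : (1 : ℝ) ≤ max (n : ℝ) 1 := le_max_right _ _
    exact div_pos (Real.log_pos (by linarith)) (Real.log_pos hC)
  rho_pos _ C hC := inv_pos.2 (one_pos.trans hC)
  rho_le_one _ C hC := (inv_lt_one_of_one_lt₀ hC).le
  estimate _ n C hC X _ _ e _ hno p hp hPhi := by
    refine hasSubseqUpperLqBlockEstimates_of_no_ell1Plus hC hno hp ?_
    have h : (1 : ℝ) ≤ max (n : ℝ) 1 := le_max_right _ _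
    rw [div_le_iff₀ (Real.log_pos hC), ← Real.le_rpow_iff_log_le (by linarith)
      (one_pos.trans hC)] at hPhi
    exact (mul_le_mul_of_nonneg_left (le_max_left _ _) two_pos.le).trans hPhi

/-- There exists an `ℓ₁⁺`-method, indexed by real numbers `a > 1`, satisfying:
(a) for all `η > 0` and `p ≥ 1` there exist `δ > 0`, `a > 1` and `C₀ > c a` such that
`Φ a (n, C) ≤ p + η` for every `C ≥ C₀` and every `n ≤ (ρ a C)^{-p-δ}`; and
(b) `ρ a C → 0` as `C → ∞`, for each `a > 1`. -/
theorem exists_ell1Plus_method :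
    ∃ M : Ell1PlusMethod {a : ℝ // 1 < a},
      (∀ η : ℝ, 0 < η → ∀ p : ℝ, 1 ≤ p →
        ∃ δ : ℝ, 0 < δ ∧ ∃ a : {a : ℝ // 1 < a}, ∃ C₀ : ℝ, M.c a < C₀ ∧
          ∀ C : ℝ, C₀ ≤ C → ∀ n : ℕ, (n : ℝ) ≤ M.rho a C ^ (-(p + δ)) →
            M.Phi a n C ≤ p + η) ∧
      (∀ a : {a : ℝ // 1 < a},
        Filter.Tendsto (fun C => M.rho a C) Filter.atTop (nhds 0)) := by
  refine ⟨logEll1PlusMethod _, fun η hη p hp => ?_, fun a => tendsto_inv_atTop_zero⟩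
  have hlog2 : 0 < Real.log 2 := Real.log_pos one_lt_two
  refine ⟨η / 2, half_pos hη, ⟨2, one_lt_two⟩, Real.exp (Real.log 2 / (η / 2)),
    Real.one_lt_exp_iff.2 (div_pos hlog2 (half_pos hη)), fun C hC n hn => ?_⟩
  change (n : ℝ) ≤ C⁻¹ ^ (-(p + η / 2)) at hn
  change Real.log (2 * max (n : ℝ) 1) / Real.log C ≤ p + η
  have hC0 : 0 < C := (Real.exp_pos _).trans_le hC
  have hlogC : Real.log 2 / (η / 2) ≤ Real.log C := (Real.le_log_iff_exp_le hC0).2 hC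
  have hlogC0 : 0 < Real.log C := (div_pos hlog2 (half_pos hη)).trans_le hlogC
  have hC1 : 1 < C := (Real.log_pos_iff hC0.le).1 hlogC0
  rw [Real.inv_rpow hC0.le, Real.rpow_neg hC0.le, inv_inv] at hn
  have hmax : max (n : ℝ) 1 ≤ C ^ (p + η / 2) :=
    max_le hn (Real.one_le_rpow hC1.le (by linarith))
  have hmax0 : 0 < max (n : ℝ) 1 := one_pos.trans_le (le_max_right _ _)
  have hlogmax := (Real.le_rpow_iff_log_le hmax0 hC0).1 hmax
  rw [div_le_iff₀ (half_pos hη)] at hlogC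
  rw [div_le_iff₀ hlogC0, Real.log_mul two_ne_zero hmax0.ne']
  linarith
end
end

section
/- Let a > 1, α ∈ (0,1), and let (ω_i)_{i=0}^∞ be natural numbers with 1 < ω_i/ω_{i−1} < a for all i ≥ 1; set σ = Σ_{i=0}^∞ α^{ω_i} (a convergent series). Let C > σ + 1, n ∈ ℕ, and let p > 1 satisfy p ≥ ω_0 · log n / log(C − σ); put q = p/(p−1). If (e_i) is a normalized monotone basic sequence in a Banach space admitting a finite normalized block sequence (y_j) with ‖Σ_j y_j‖ > C (Σ_j ‖y_j‖^q)^{1/q}, then (e_i) admits a normalized block sequence of length n which is an ℓ₁⁺-ρ-sequence with ρ = α(C − σ)^{−a/ω_0}. -/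
set_option maxSynthPendingDepth 3
set_option maxHeartbeats 1000000
set_option synthInstance.maxHeartbeats 400000

noncomputable section

/-- Linear combinations over successive nonempty index sets of a block sequence form a block
sequence. -/
theorem IsBlockSeqOf.sum_smul {X : Type*} [NormedAddCommGroup X] [NormedSpace ℝ X]
    {e : ℕ → X} {M K : ℕ} {x : Fin M → X} (hx : IsBlockSeqOf e x) (c : Fin M → ℝ)
    (S : Fin K → Finset (Fin M)) (hne : ∀ g, (S g).Nonempty)
    (hS : ∀ g h, g < h → ∀ j ∈ S g, ∀ k ∈ S h, j < k) :
    IsBlockSeqOf e fun g => ∑ j ∈ S g, c j • x j := by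
  classical
  obtain ⟨I, b, hI, hlt, hxb⟩ := hx
  have hdisj : ∀ j k i, i ∈ I j → i ∈ I k → j = k := by
    intro j k i hj hk
    rcases lt_trichotomy j k with h | h | h
    · exact absurd (hlt j k h i hj i hk) (lt_irrefl i)
    · exact h
    · exact absurd (hlt k j h i hk i hj) (lt_irrefl i)
  refine ⟨fun g => (S g).biUnion I, fun i => ∑ j, if i ∈ I j then c j * b i else 0, ?_, ?_, ?_⟩
  · exact fun g => (hne g).biUnion fun j _ => hI j
  · intro g h hgh i hi i' hi'
    obtain ⟨j, hj, hij⟩ := Finset.mem_biUnion.1 hi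
    obtain ⟨k, hk, hik⟩ := Finset.mem_biUnion.1 hi'
    exact hlt j k (hS g h hgh j hj k hk) i hij i' hik
  · intro g
    rw [Finset.sum_biUnion]
    · refine Finset.sum_congr rfl fun j _ => ?_
      rw [hxb j, Finset.smul_sum]
      refine Finset.sum_congr rfl fun i hi => ?_
      dsimp only
      rw [Finset.sum_eq_single j, if_pos hi, mul_smul]
      · exact fun k _ hkj => if_neg fun hik => hkj (hdisj k j i hik hi)
      · simp
    · intro j _ k _ hjk
      exact Finset.disjoint_left.2 fun i hj hk => hjk (hdisj j k i hj hk)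

/-- A subsequence of a block sequence is a block sequence. -/
theorem IsBlockSeqOf.comp_strictMono {X : Type*} [NormedAddCommGroup X] [NormedSpace ℝ X]
    {e : ℕ → X} {M K : ℕ} {x : Fin M → X} (hx : IsBlockSeqOf e x) {φ : Fin K → Fin M}
    (hφ : StrictMono φ) : IsBlockSeqOf e fun g => x (φ g) := by
  obtain ⟨I, b, hI, hlt, hxb⟩ := hx
  exact ⟨fun g => I (φ g), b, fun g => hI _, fun j k hjk => hlt _ _ (hφ hjk), fun g => hxb _⟩

/-- The blocking argument of James: a normalized block sequence of length `n ^ (k + 1)` on which a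
functional of norm at most one is at least `ρ ^ (k + 1)` yields a block sequence of length `n`
that is an `ℓ₁⁺`-`ρ`-sequence. -/
theorem exists_ell1Plus_of_pow {X : Type*} [NormedAddCommGroup X] [NormedSpace ℝ X]
    {e : ℕ → X} {ρ : ℝ} (hρ : 0 < ρ) {n : ℕ} (hn : 0 < n) (f : X →L[ℝ] ℝ) (hf : ‖f‖ ≤ 1)
    (k : ℕ) : ∀ {M : ℕ}, M = n ^ k * n → ∀ x : Fin M → X, IsBlockSeqOf e x →
      (∀ j, ‖x j‖ = 1) → (∀ j, ρ ^ (k + 1) ≤ f (x j)) →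
      ∃ z : Fin n → X, IsBlockSeqOf e z ∧ IsEll1PlusSeq ρ z := by
  induction k with
  | zero =>
    intro M hM x hx hx1 hfx
    obtain rfl : M = n := by simpa using hM
    refine ⟨x, hx, hx1, fun a ha => ?_⟩
    calc ρ * ∑ j, a j = ∑ j, a j * ρ := by rw [mul_comm, Finset.sum_mul]
      _ ≤ ∑ j, a j * f (x j) :=
        Finset.sum_le_sum fun j _ => mul_le_mul_of_nonneg_left (by simpa using hfx j) (ha j)
      _ = f (∑ j, a j • x j) := by simp
      _ ≤ ‖f (∑ j, a j • x j)‖ := le_abs_self _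
      _ ≤ 1 * ‖∑ j, a j • x j‖ := f.le_of_opNorm_le hf _
      _ = _ := one_mul _
  | succ k ih =>
    intro M hM x hx hx1 hfx
    subst hM
    set φ : Fin (n ^ (k + 1)) → Fin n → Fin (n ^ (k + 1) * n) :=
      fun g i => finProdFinEquiv (g, i) with hφ
    have hφval : ∀ g i, (φ g i : ℕ) = i + n * g := fun g i => rfl
    have hφmono : ∀ g, StrictMono (φ g) := by
      intro g i i' h
      rw [Fin.lt_def, hφval, hφval]
      exact Nat.add_lt_add_right h _
    by_cases H : ∃ g, IsEll1PlusSeq ρ fun i => x (φ g i)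
    · obtain ⟨g, hg⟩ := H
      exact ⟨_, hx.comp_strictMono (hφmono g), hg⟩
    have H' : ∀ g, ∃ a : Fin n → ℝ, (∀ i, 0 ≤ a i) ∧
        ‖∑ i, a i • x (φ g i)‖ < ρ * ∑ i, a i := by
      intro g
      by_contra hcon
      push Not at hcon
      exact H ⟨g, fun i => hx1 _, hcon⟩
    choose a ha hlt using H'
    set w : Fin (n ^ (k + 1)) → X := fun g => ∑ i, a g i • x (φ g i) with hw
    have hfw : ∀ g, ρ ^ (k + 1) * (ρ * ∑ i, a g i) ≤ f (w g) := by
      intro g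
      calc ρ ^ (k + 1) * (ρ * ∑ i, a g i) = ∑ i, a g i * ρ ^ (k + 1 + 1) := by
            rw [← Finset.sum_mul]; ring
        _ ≤ ∑ i, a g i * f (x (φ g i)) :=
          Finset.sum_le_sum fun i _ => mul_le_mul_of_nonneg_left (hfx _) (ha g i)
        _ = f (w g) := by simp [hw]
    have hpos : ∀ g, 0 < ρ * ∑ i, a g i := fun g => (norm_nonneg _).trans_lt (hlt g)
    have hwpos : ∀ g, 0 < ‖w g‖ := by
      intro g
      refine norm_pos_iff.2 fun h0 => ?_
      have h1 := hfw g
      rw [h0, map_zero] at h1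
      exact absurd (mul_pos (pow_pos hρ (k + 1)) (hpos g)) (not_lt.2 h1)
    have hblock : IsBlockSeqOf e fun g => ‖w g‖⁻¹ • w g := by
      have h := hx.sum_smul (fun j => ‖w (finProdFinEquiv.symm j).1‖⁻¹ *
          a (finProdFinEquiv.symm j).1 (finProdFinEquiv.symm j).2)
        (fun g => Finset.univ.map ⟨φ g, (hφmono g).injective⟩)
        (fun g => ⟨φ g ⟨0, hn⟩, by simp⟩) (by
          intro g h hgh j hj j' hj'
          simp only [Finset.mem_map, Finset.mem_univ, true_and,
            Function.Embedding.coeFn_mk] at hj hj'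
          obtain ⟨i, rfl⟩ := hj
          obtain ⟨i', rfl⟩ := hj'
          rw [Fin.lt_def, hφval, hφval]
          have h1 : (g : ℕ) + 1 ≤ h := hgh
          have h2 := Nat.mul_le_mul_left n h1
          have h3 := i.isLt
          rw [mul_add] at h2
          omega)
      convert h using 2 with g
      rw [Finset.sum_map, Finset.smul_sum]
      refine Finset.sum_congr rfl fun i _ => ?_
      have hsymm : finProdFinEquiv.symm (φ g i) = (g, i) := Equiv.symm_apply_apply _ _
      simp only [Function.Embedding.coeFn_mk, hsymm, mul_smul]
    refine ih (pow_succ n k) _ hblock (fun g => ?_) (fun g => ?_)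
    · rw [norm_smul, norm_inv, norm_norm, inv_mul_cancel₀ (hwpos g).ne']
    · rw [map_smul, smul_eq_mul, inv_mul_eq_div, le_div_iff₀ (hwpos g)]
      exact (mul_le_mul_of_nonneg_left (hlt g).le (pow_pos hρ _).le).trans (hfw g)

/-- If there is no `ℓ₁⁺`-`ρ` block sequence of length `n`, then a functional of norm at most one
exceeds `ρ ^ k` on fewer than `n ^ k` members of a normalized block sequence. -/
theorem card_filter_lt_pow {X : Type*} [NormedAddCommGroup X] [NormedSpace ℝ X]
    {e : ℕ → X} {ρ : ℝ} (hρ : 0 < ρ) {n : ℕ} (hn : 0 < n)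
    (hno : ¬ ∃ z : Fin n → X, IsBlockSeqOf e z ∧ IsEll1PlusSeq ρ z)
    (f : X →L[ℝ] ℝ) (hf : ‖f‖ ≤ 1) {m : ℕ} {y : Fin m → X} (hy : IsBlockSeqOf e y)
    (hy1 : ∀ j, ‖y j‖ = 1) {k : ℕ} (hk : 0 < k) :
    (Finset.univ.filter fun j => ρ ^ k ≤ f (y j)).card < n ^ k := by
  obtain ⟨k, rfl⟩ := Nat.exists_eq_succ_of_ne_zero hk.ne'
  by_contra! hcard
  set φ := Finset.orderEmbOfCardLe _ hcard
  refine hno (exists_ell1Plus_of_pow hρ hn f hf k (pow_succ n k) _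
    (hy.comp_strictMono φ.strictMono) (fun j => hy1 _) fun j => ?_)
  exact (Finset.mem_filter.1 (Finset.orderEmbOfCardLe_mem _ hcard j)).2

/-- A cardinality at most `n ^ w` and at most `m` is bounded by interpolation, if
`p ≥ w₀ log n / log D`. -/
theorem natCast_le_rpow_mul_rpow {c n m w w₀ : ℕ} {D p : ℝ} (hn : 0 < n) (hw₀ : 0 < w₀)
    (hD : 1 < D) (hp1 : 1 < p) (hp : (w₀ : ℝ) * Real.log n / Real.log D ≤ p)
    (hc : c ≤ n ^ w) (hcm : c ≤ m) :
    (c : ℝ) ≤ D ^ ((w : ℝ) / w₀) * (m : ℝ) ^ (1 / (p / (p - 1))) := by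
  have hp0 : 0 < p := by linarith
  have hw₀' : (0 : ℝ) < w₀ := by exact_mod_cast hw₀
  have hn' : (0 : ℝ) < n := by exact_mod_cast hn
  have hlog : 0 < Real.log D := Real.log_pos hD
  have hq : 1 / p + 1 / (p / (p - 1)) = 1 := by
    have : p - 1 ≠ 0 := by linarith
    field_simp
    ring
  have hq0 : 0 ≤ 1 / (p / (p - 1)) := by
    have : 0 < p - 1 := by linarith
    positivity
  have h1 : (c : ℝ) = (c : ℝ) ^ (1 / p) * (c : ℝ) ^ (1 / (p / (p - 1))) := by
    rw [← Real.rpow_add' (Nat.cast_nonneg c) (by rw [hq]; exact one_ne_zero), hq, Real.rpow_one]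
  have h2 : (c : ℝ) ^ (1 / p) ≤ D ^ ((w : ℝ) / w₀) := by
    calc (c : ℝ) ^ (1 / p) ≤ ((n : ℝ) ^ w) ^ (1 / p) :=
          Real.rpow_le_rpow (Nat.cast_nonneg c) (by exact_mod_cast hc) (by positivity)
      _ ≤ D ^ ((w : ℝ) / w₀) := by
        rw [Real.rpow_def_of_pos (pow_pos hn' w), Real.rpow_def_of_pos (by linarith : 0 < D),
          Real.log_pow, Real.exp_le_exp]
        rw [div_le_iff₀ hlog] at hp
        have h3 : Real.log n / p ≤ Real.log D / w₀ := by
          rw [div_le_div_iff₀ hp0 hw₀']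
          linarith
        calc (w : ℝ) * Real.log n * (1 / p) = w * (Real.log n / p) := by ring
          _ ≤ w * (Real.log D / w₀) := mul_le_mul_of_nonneg_left h3 (Nat.cast_nonneg w)
          _ = _ := by ring
  calc (c : ℝ) = (c : ℝ) ^ (1 / p) * (c : ℝ) ^ (1 / (p / (p - 1))) := h1
    _ ≤ _ := mul_le_mul h2 (Real.rpow_le_rpow (Nat.cast_nonneg c) (by exact_mod_cast hcm) hq0)
      (by positivity) (by positivity)

/-- The scalar estimate controlling the contribution of one level set. -/
theorem rpow_mul_pow_le_pow {α a D : ℝ} {v w w₀ : ℕ} (hα : 0 < α) (hD : 1 < D)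
    (hvw : (v : ℝ) ≤ a * w) :
    D ^ ((v : ℝ) / w₀) * (α * D ^ (-(a / (w₀ : ℝ)))) ^ w ≤ α ^ w := by
  have hD0 : 0 < D := by linarith
  rw [mul_pow, mul_left_comm, ← Real.rpow_natCast (D ^ _) w, ← Real.rpow_mul hD0.le,
    ← Real.rpow_add hD0]
  refine mul_le_of_le_one_right (pow_pos hα w).le (Real.rpow_le_one_of_one_le_of_nonpos hD.le ?_)
  have : (v : ℝ) / w₀ + -(a / w₀) * w = (v - a * w) / w₀ := by ring
  rw [this]
  exact div_nonpos_of_nonpos_of_nonneg (by linarith) (Nat.cast_nonneg w₀)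

/-- Let `a > 1`, `α ∈ (0,1)`, and `(ωᵢ)` be natural numbers with `1 < ωᵢ/ω_{i-1} < a`;
set `σ = ∑ᵢ α^{ωᵢ}`. Let `C > σ + 1`, `n ∈ ℕ`, and let `p > 1` satisfy
`p ≥ ω₀ · log n / log (C - σ)`; put `q = p/(p-1)`. If `(eᵢ)` is a normalized monotone
basic sequence admitting a finite normalized block sequence `(yⱼ)` with
`‖∑ⱼ yⱼ‖ > C (∑ⱼ ‖yⱼ‖^q)^{1/q}`, then `(eᵢ)` admits a normalized block sequence of
length `n` which is an `ℓ₁⁺`-`ρ`-sequence with `ρ = α (C - σ)^{-a/ω₀}`. -/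
theorem exists_ell1Plus_block_seq_of_large_sum
    (a α : ℝ) (ha : 1 < a) (hα0 : 0 < α) (hα1 : α < 1)
    (ω : ℕ → ℕ)
    (hω : ∀ i : ℕ, 1 ≤ i →
      1 < (ω i : ℝ) / (ω (i - 1) : ℝ) ∧ (ω i : ℝ) / (ω (i - 1) : ℝ) < a)
    (C : ℝ) (hC : (∑' i : ℕ, α ^ ω i) + 1 < C)
    (n : ℕ) (hn : 0 < n)
    (p : ℝ) (hp1 : 1 < p)
    (hp : (ω 0 : ℝ) * Real.log n / Real.log (C - ∑' i : ℕ, α ^ ω i) ≤ p)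
    (X : Type*) [NormedAddCommGroup X] [NormedSpace ℝ X] [CompleteSpace X]
    (e : ℕ → X) (he : IsNormalizedMonotoneBasicSeq e)
    (m : ℕ) (y : Fin m → X) (hyblock : IsBlockSeqOf e y) (hynorm : ∀ j, ‖y j‖ = 1)
    (hy : C * (∑ j, ‖y j‖ ^ (p / (p - 1))) ^ (1 / (p / (p - 1))) < ‖∑ j, y j‖) :
    ∃ z : Fin n → X, IsBlockSeqOf e z ∧
      IsEll1PlusSeq (α * (C - ∑' i : ℕ, α ^ ω i) ^ (-(a / (ω 0 : ℝ)))) z := by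
  have hstep : ∀ i, 0 < ω i ∧ ω i < ω (i + 1) ∧ (ω (i + 1) : ℝ) ≤ a * ω i := by
    intro i
    obtain ⟨h1, h2⟩ := hω (i + 1) (Nat.le_add_left 1 i)
    rw [Nat.add_sub_cancel] at h1 h2
    have hpos : 0 < ω i := by
      refine Nat.pos_of_ne_zero fun h0 => ?_
      rw [h0, Nat.cast_zero, div_zero] at h1
      linarith
    have hpos' : (0 : ℝ) < ω i := by exact_mod_cast hpos
    rw [one_lt_div hpos'] at h1
    rw [div_lt_iff₀ hpos'] at h2
    exact ⟨hpos, by exact_mod_cast h1, h2.le⟩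
  have hmono : StrictMono ω := strictMono_nat_of_lt_succ fun i => (hstep i).2.1
  have hsum : Summable fun i => α ^ ω i :=
    (summable_geometric_of_lt_one hα0.le hα1).of_nonneg_of_le (fun i => by positivity)
      fun i => pow_le_pow_of_le_one hα0.le hα1.le (hmono.id_le i)
  set σ : ℝ := ∑' i : ℕ, α ^ ω i with hσ
  have hD : 1 < C - σ := by linarith
  have hD0 : 0 < C - σ := by linarith
  set ρ : ℝ := α * (C - σ) ^ (-(a / (ω 0 : ℝ))) with hρdef
  have hρ : 0 < ρ := by positivity
  have hρ1 : ρ < 1 := by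
    have h : (C - σ) ^ (-(a / (ω 0 : ℝ))) ≤ 1 :=
      Real.rpow_le_one_of_one_le_of_nonpos hD.le (neg_nonpos.2 (by positivity))
    exact (mul_le_of_le_one_right hα0.le h).trans_lt hα1
  by_contra hno
  obtain ⟨f, hf, hfy⟩ := exists_dual_vector'' ℝ (∑ j, y j)
  set Q : ℝ := (m : ℝ) ^ (1 / (p / (p - 1))) with hQ
  have hQ0 : 0 ≤ Q := by positivity
  have hle1 : ∀ j, f (y j) ≤ 1 := fun j =>
    (le_abs_self _).trans ((f.le_of_opNorm_le hf _).trans (by rw [hynorm j, one_mul]))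
  set U : ℕ → Finset (Fin m) := fun i => Finset.univ.filter fun j => ρ ^ ω i ≤ f (y j) with hU
  have hcard : ∀ i, ((U i).card : ℝ) ≤ (C - σ) ^ ((ω i : ℝ) / ω 0) * Q := fun i =>
    natCast_le_rpow_mul_rpow hn (hstep 0).1 hD hp1 hp
      (card_filter_lt_pow hρ hn hno f hf hyblock hynorm (hstep i).1).le
      ((Finset.card_le_univ _).trans_eq (Fintype.card_fin m))
  have hlevel : ∀ K, ∑ j ∈ U K, f (y j) ≤ (C - σ + ∑ i ∈ Finset.range K, α ^ ω i) * Q := by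
    intro K
    induction K with
    | zero =>
      have h0 : (ω 0 : ℝ) ≠ 0 := by exact_mod_cast (hstep 0).1.ne'
      have h := hcard 0
      rw [div_self h0, Real.rpow_one] at h
      refine (Finset.sum_le_card_nsmul _ _ 1 fun j _ => hle1 j).trans ?_
      simpa using h
    | succ K ih =>
      have hsub : U K ⊆ U (K + 1) := Finset.monotone_filter_right _ fun j _ hj =>
        (pow_le_pow_of_le_one hρ.le hρ1.le (hstep K).2.1.le).trans hj
      have hnew : ∑ j ∈ U (K + 1) \ U K, f (y j) ≤ α ^ ω K * Q := by
        calc ∑ j ∈ U (K + 1) \ U K, f (y j) ≤ (U (K + 1) \ U K).card • ρ ^ ω K := by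
              refine Finset.sum_le_card_nsmul _ _ _ fun j hj => ?_
              have hj' := (Finset.mem_sdiff.1 hj).2
              simp only [hU, Finset.mem_filter, Finset.mem_univ, true_and, not_le] at hj'
              exact hj'.le
          _ = (U (K + 1) \ U K).card * ρ ^ ω K := nsmul_eq_mul _ _
          _ ≤ (U (K + 1)).card * ρ ^ ω K := by
            gcongr
            exact Finset.sdiff_subset
          _ ≤ ((C - σ) ^ ((ω (K + 1) : ℝ) / ω 0) * Q) * ρ ^ ω K := by
            gcongr
            exact hcard (K + 1)
          _ = ((C - σ) ^ ((ω (K + 1) : ℝ) / ω 0) * ρ ^ ω K) * Q := by ring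
          _ ≤ α ^ ω K * Q :=
            mul_le_mul_of_nonneg_right (rpow_mul_pow_le_pow hα0 hD (hstep K).2.2) hQ0
      rw [← Finset.sum_sdiff hsub, Finset.sum_range_succ]
      linarith
  have hexists : ∃ K, ∀ j, 0 < f (y j) → ρ ^ ω K ≤ f (y j) := by
    have htend := (tendsto_pow_atTop_nhds_zero_of_lt_one hρ.le hρ1).comp hmono.tendsto_atTop
    refine (Filter.eventually_all.2 fun j => ?_ : ∀ᶠ K in Filter.atTop,
      ∀ j, 0 < f (y j) → ρ ^ ω K ≤ f (y j)).exists
    by_cases hj : 0 < f (y j)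
    · filter_upwards [htend.eventually_le_const hj] with K hK _ using hK
    · exact Filter.Eventually.of_forall fun K h => absurd h hj
  obtain ⟨K, hK⟩ := hexists
  have htotal : ‖∑ j, y j‖ ≤ ∑ j ∈ U K, f (y j) := by
    have h : ‖∑ j, y j‖ = ∑ j, f (y j) := by
      rw [← map_sum]
      exact hfy.symm
    rw [h, ← Finset.sum_filter_add_sum_filter_not Finset.univ fun j => ρ ^ ω K ≤ f (y j)]
    refine add_le_of_nonpos_right (Finset.sum_nonpos fun j hj => ?_)
    exact not_lt.1 fun hpos => (Finset.mem_filter.1 hj).2 (hK j hpos)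
  have hpartial : ∑ i ∈ Finset.range K, α ^ ω i ≤ σ :=
    hsum.sum_le_tsum _ fun i _ => by positivity
  have hbound : ‖∑ j, y j‖ ≤ C * Q :=
    (htotal.trans (hlevel K)).trans (mul_le_mul_of_nonneg_right (by linarith) hQ0)
  simp only [hynorm, Real.one_rpow, Finset.sum_const, Finset.card_univ, Fintype.card_fin,
    nsmul_eq_mul, mul_one] at hy
  exact absurd hbound (not_le.2 hy)
end
end
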